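/- Let k ≥ 2 be an integer, t ∈ (0,1), and z ∈ ℂ with |z| = 1. Then there do not exist complex numbers a, b, c, d with a·d − b·c ≠ 0 such that (a·B_{z,t,k}(w) + b)·(c·w + d)^k = (c·B_{z,t,k}(w) + d)·(a·w + b)^k for all w ∈ ℂ with 1 + t·w ≠ 0. In other words, B_{z,t,k} is not conjugate to the power map w ↦ w^k by any Möbius transformation. -/

import Mathlib

/-- The Blaschke product `B_{z,t,k}(w) = z·((w + t)/(1 + w·t))^k`. -/
noncomputable def Blaschke (z : ℂ) (t : ℝ) (k : ℕ) (w : ℂ) : ℂ :=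
  z * ((w + (t : ℂ)) / (1 + w * (t : ℂ))) ^ k

/-- Clearing denominators in a conjugacy between `Blaschke z t k` and the `k`-th power map gives an
identity of polynomial functions on all of `ℂ`. -/
lemma Blaschke.cleared_identity {k : ℕ} {t : ℝ} (ht : t ≠ 0) {z a b c d : ℂ}
    (h : ∀ w : ℂ, 1 + (t : ℂ) * w ≠ 0 →
      (a * Blaschke z t k w + b) * (c * w + d) ^ k =
        (c * Blaschke z t k w + d) * (a * w + b) ^ k) :
    (fun w : ℂ ↦ (a * z * (w + t) ^ k + b * (1 + t * w) ^ k) * (c * w + d) ^ k) =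
      fun w : ℂ ↦ (c * z * (w + t) ^ k + d * (1 + t * w) ^ k) * (a * w + b) ^ k := by
  have htC : (t : ℂ) ≠ 0 := by exact_mod_cast ht
  refine Continuous.ext_on (dense_compl_singleton (-(t : ℂ)⁻¹)) (by fun_prop) (by fun_prop) ?_
  intro w hw
  have hv : 1 + (t : ℂ) * w ≠ 0 := by
    intro h0
    apply hw
    rw [Set.mem_singleton_iff]
    field_simp
    linear_combination h0
  have hvk := pow_ne_zero k hv
  have hB : Blaschke z t k w * (1 + (t : ℂ) * w) ^ k = z * (w + t) ^ k := by
    rw [Blaschke, mul_comm w (t : ℂ), div_pow, mul_assoc, div_mul_cancel₀ _ hvk]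
  linear_combination (1 + (t : ℂ) * w) ^ k * h w hv
    - (a * (c * w + d) ^ k - c * (a * w + b) ^ k) * hB

theorem stmt15 (k : ℕ) (hk : 2 ≤ k) (t : ℝ) (ht0 : 0 < t) (ht1 : t < 1)
    (z : ℂ) (hz : ‖z‖ = 1) :
    ¬ ∃ a b c d : ℂ, a * d - b * c ≠ 0 ∧
      ∀ w : ℂ, 1 + (t : ℂ) * w ≠ 0 →
        (a * Blaschke z t k w + b) * (c * w + d) ^ k =
          (c * Blaschke z t k w + d) * (a * w + b) ^ k := by
  rintro ⟨a, b, c, d, hdet, h⟩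
  have key := Blaschke.cleared_identity ht0.ne' h
  have htC : (t : ℂ) ≠ 0 := by exact_mod_cast ht0.ne'
  have ht2 : (1 : ℂ) - t * t ≠ 0 := by
    have : (1 : ℝ) - t * t ≠ 0 := by nlinarith
    exact_mod_cast this
  have hz0 : z ≠ 0 := by
    rintro rfl
    simp at hz
  obtain ⟨n, rfl⟩ : ∃ n, k = n + 2 := ⟨k - 2, by omega⟩
  by_cases ha : a = 0
  · subst ha
    have hb : b ≠ 0 := by rintro rfl; simp at hdet
    have hc : c ≠ 0 := by rintro rfl; simp at hdet
    have e := congrFun key (-(t : ℂ)⁻¹)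
    have hu : -(t : ℂ)⁻¹ + t ≠ 0 := by
      intro h0
      apply ht2
      field_simp at h0
      linear_combination -h0
    simp [htC, hb, hc, hz0, hu] at e
  · set w₀ : ℂ := -b / a with hw₀
    have hX : a * w₀ + b = 0 := by rw [hw₀]; field_simp; ring
    have hY : c * w₀ + d ≠ 0 := by
      intro h0
      apply hdet
      linear_combination a * h0 - c * hX
    have hYk := pow_ne_zero (n + 2) hY
    have hP : a * z * (w₀ + t) ^ (n + 2) + b * (1 + t * w₀) ^ (n + 2) = 0 := by
      have e := congrFun key w₀
      simp only [hX] at e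
      simpa [hYk, hY] using e
    have dlin (p q : ℂ) : HasDerivAt (fun w : ℂ ↦ p * w + q) p w₀ := by
      simpa using ((hasDerivAt_id w₀).const_mul p).add_const q
    have du : HasDerivAt (fun w : ℂ ↦ w + (t : ℂ)) 1 w₀ := (hasDerivAt_id w₀).add_const _
    have dv : HasDerivAt (fun w : ℂ ↦ 1 + (t : ℂ) * w) t w₀ := by
      simpa [add_comm] using dlin t 1
    have dcomb (p q : ℂ) := ((du.fun_pow (n + 2)).const_mul p).fun_add
      ((dv.fun_pow (n + 2)).const_mul q)
    have dL := (dcomb (a * z) b).fun_mul ((dlin c d).fun_pow (n + 2))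
    have dR := (dcomb (c * z) d).fun_mul ((dlin a b).fun_pow (n + 2))
    rw [key] at dL
    have e := dL.unique dR
    have hn : ((n : ℂ) + 2) ≠ 0 := by exact_mod_cast (by omega : n + 2 ≠ 0)
    have hP' : a * z * (w₀ + t) ^ (n + 1) + b * t * (1 + t * w₀) ^ (n + 1) = 0 := by
      simp only [hX, hP, show n + 2 - 1 = n + 1 from rfl] at e
      have e' : (c * w₀ + d) ^ (n + 2) * ((n + 2) *
          (a * z * (w₀ + t) ^ (n + 1) + b * t * (1 + t * w₀) ^ (n + 1))) = 0 := by
        push_cast at e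
        simp only [ne_eq, Nat.add_eq_zero_iff, OfNat.ofNat_ne_zero, one_ne_zero, and_false,
          not_false_eq_true, zero_pow, mul_zero, zero_mul, add_zero] at e
        linear_combination e
      exact (mul_eq_zero.mp ((mul_eq_zero.mp e').resolve_left hYk)).resolve_left hn
    have hbv : b * (1 + t * w₀) ^ (n + 1) = 0 := by
      refine (mul_eq_zero.mp ?_).resolve_left ht2
      linear_combination hP - (w₀ + t) * hP'
    have hu : w₀ + t = 0 := by
      have h0 : a * z * (w₀ + t) ^ (n + 1) = 0 := by linear_combination hP' - t * hbv
      exact eq_zero_of_pow_eq_zero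
        ((mul_eq_zero.mp h0).resolve_left (mul_ne_zero ha hz0))
    have hv : 1 + t * w₀ ≠ 0 := by
      intro h0
      apply ht2
      linear_combination h0 - t * hu
    have hb : b = 0 := (mul_eq_zero.mp hbv).resolve_right (pow_ne_zero _ hv)
    apply htC
    simpa [hw₀, hb] using hu
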